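/- Let D and D' be bounded domains in ℂ, let p > 2, and let f : D → D' be a Q-homeomorphism with respect to the p-modulus, where Q(z) ≤ K < ∞ for almost every z ∈ D. Then for every z₀ ∈ D and all r ∈ (0, d₀), where d₀ = dist(z₀, ∂D), one has |f(B(z₀,r))| ≥ K^{2/(2−p)} · |B(z₀,r)|. -/

import Mathlib

open MeasureTheory Set Metric Complex ENNReal

noncomputable section

open Classical in
/-- The line integral `∫_γ ρ |dz|` of a Borel density `ρ` along a curve `γ`
(parametrized on `[0,1]`), with the convention that the integral is `∞`
for curves that are not rectifiable (here: not Lipschitz on `[0,1]`). -/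
def lineIntegral (ρ : ℂ → ℝ≥0∞) (γ : ℝ → ℂ) : ℝ≥0∞ :=
  if ∃ K : NNReal, LipschitzOnWith K γ (Set.Icc 0 1) then
    ∫⁻ t in Set.Icc (0 : ℝ) 1, ρ (γ t) * (‖deriv γ t‖₊ : ℝ≥0∞)
  else ⊤

/-- A Borel function `ρ : ℂ → [0,∞]` is admissible for the curve family `Γ`
if `∫_γ ρ |dz| ≥ 1` for every `γ ∈ Γ`. -/
def IsAdmissible (ρ : ℂ → ℝ≥0∞) (Γ : Set (ℝ → ℂ)) : Prop :=
  Measurable ρ ∧ ∀ γ ∈ Γ, 1 ≤ lineIntegral ρ γ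

/-- The `p`-modulus of a family `Γ` of curves in `ℂ`:
`M_p(Γ) = inf { ∫_ℂ ρ^p dm : ρ admissible for Γ }`. -/
def pModulus (p : ℝ) (Γ : Set (ℝ → ℂ)) : ℝ≥0∞ :=
  ⨅ (ρ : ℂ → ℝ≥0∞) (_ : IsAdmissible ρ Γ), ∫⁻ z : ℂ, ρ z ^ p

/-- `Γ` is a family of curves lying in the set `D`. -/
def CurveFamilyIn (Γ : Set (ℝ → ℂ)) (D : Set ℂ) : Prop :=
  ∀ γ ∈ Γ, ContinuousOn γ (Set.Icc 0 1) ∧ ∀ t ∈ Set.Icc (0 : ℝ) 1, γ t ∈ D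

/-- `f` is a homeomorphism of `D` onto its image: continuous, injective and open on `D`. -/
def IsHomeoOn (f : ℂ → ℂ) (D : Set ℂ) : Prop :=
  ContinuousOn f D ∧ Set.InjOn f D ∧ ∀ U ⊆ D, IsOpen U → IsOpen (f '' U)

/-- `f` is a `Q`-homeomorphism with respect to the `p`-modulus on `D`:
`M_p(fΓ) ≤ ∫_D Q(z) ρ(z)^p dm(z)` for every curve family `Γ` in `D` and every
`ρ` admissible for `Γ`. -/
def IsQHomeo (p : ℝ) (D : Set ℂ) (Q : ℂ → ℝ≥0∞) (f : ℂ → ℂ) : Prop :=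
  IsHomeoOn f D ∧
    ∀ Γ : Set (ℝ → ℂ), CurveFamilyIn Γ D → ∀ ρ : ℂ → ℝ≥0∞, IsAdmissible ρ Γ →
      pModulus p ((fun γ => f ∘ γ) '' Γ) ≤ ∫⁻ z in D, Q z * ρ z ^ p

/-- The integral mean `q_{z₀}(r) = (1/(2πr)) ∫_{S(z₀,r)} Q(z) |dz|` of `Q` over the
circle `S(z₀,r)`, computed via the arclength parametrization `θ ↦ z₀ + r e^{iθ}`. -/
def circleMean (Q : ℂ → ℝ≥0∞) (z₀ : ℂ) (r : ℝ) : ℝ≥0∞ :=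
  (∫⁻ θ in Set.Icc (0 : ℝ) (2 * Real.pi),
      Q (z₀ + (r : ℂ) * Complex.exp ((θ : ℂ) * Complex.I))) / ENNReal.ofReal (2 * Real.pi)

section

open scoped NNReal Topology ComplexConjugate
open Filter

lemma norm_deriv_lipschitz_comp_le {ψ : ℂ → ℝ} {C : ℝ≥0} (hψ : LipschitzWith C ψ) {γ : ℝ → ℂ}
    {t : ℝ} (hγ : DifferentiableAt ℝ γ t) :
    ‖deriv (ψ ∘ γ) t‖ ≤ C * ‖deriv γ t‖ := by
  by_cases hd : DifferentiableAt ℝ (ψ ∘ γ) t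
  · have h1 := (hasDerivAt_iff_tendsto_slope.1 hd.hasDerivAt).norm
    have h2 := ((hasDerivAt_iff_tendsto_slope.1 hγ.hasDerivAt).norm).const_mul (C : ℝ)
    refine le_of_tendsto_of_tendsto' h1 h2 fun s => ?_
    have h3 := hψ.norm_sub_le (γ s) (γ t)
    simp only [slope, vsub_eq_sub, norm_smul, Function.comp]
    calc _ ≤ ‖(s - t)⁻¹‖ * (C * ‖γ s - γ t‖) := by gcongr
      _ = _ := by ring
  · rw [deriv_zero_of_not_differentiableAt hd, norm_zero]
    positivity

/-- A Lipschitz function that is locally constant along the part of a curve outside `U` varies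
by at most its Lipschitz constant times the length of the part of the curve inside `U`. -/
lemma ofReal_sub_le_lintegral_indicator {ψ : ℂ → ℝ} {C : ℝ≥0} (hψ : LipschitzWith C ψ)
    {γ : ℝ → ℂ} {L : ℝ≥0} (hγ : LipschitzOnWith L γ (Icc 0 1)) {U : Set ℂ}
    (hU : ∀ t ∈ Ioo (0 : ℝ) 1, γ t ∈ U ∨ ∀ᶠ z in 𝓝 (γ t), ψ z = ψ (γ t)) :
    ENNReal.ofReal (ψ (γ 1) - ψ (γ 0)) ≤
      C * ∫⁻ t in Icc (0 : ℝ) 1, U.indicator 1 (γ t) * (‖deriv γ t‖₊ : ℝ≥0∞) := by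
  have hlip : LipschitzOnWith (C * L) (ψ ∘ γ) (uIcc 0 1) := by
    rw [uIcc_of_le zero_le_one]
    exact hψ.comp_lipschitzOnWith hγ
  have hftc := hlip.absolutelyContinuousOnInterval.integral_deriv_eq_sub
  rw [intervalIntegral.integral_of_le zero_le_one] at hftc
  have hdiff : ∀ᵐ t ∂volume.restrict (Ioo (0 : ℝ) 1), DifferentiableAt ℝ γ t := by
    have h := (hγ.mono Ioo_subset_Icc_self).ae_differentiableWithinAt_real measurableSet_Ioo
    filter_upwards [h, ae_restrict_mem measurableSet_Ioo] with t ht htI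
    exact ht.differentiableAt (isOpen_Ioo.mem_nhds htI)
  calc ENNReal.ofReal (ψ (γ 1) - ψ (γ 0))
      ≤ ‖∫ t in Ioc (0 : ℝ) 1, deriv (ψ ∘ γ) t‖ₑ := by
        rw [hftc, Real.enorm_eq_ofReal_abs]
        exact ENNReal.ofReal_le_ofReal (le_abs_self _)
    _ ≤ ∫⁻ t in Ioc (0 : ℝ) 1, ‖deriv (ψ ∘ γ) t‖ₑ := enorm_integral_le_lintegral_enorm _
    _ = ∫⁻ t in Ioo (0 : ℝ) 1, ‖deriv (ψ ∘ γ) t‖ₑ := by rw [restrict_Ioo_eq_restrict_Ioc]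
    _ ≤ ∫⁻ t in Ioo (0 : ℝ) 1, C * (U.indicator 1 (γ t) * (‖deriv γ t‖₊ : ℝ≥0∞)) := by
        refine lintegral_mono_ae ?_
        filter_upwards [hdiff, ae_restrict_mem measurableSet_Ioo] with t ht htI
        by_cases hconst : ∀ᶠ z in 𝓝 (γ t), ψ z = ψ (γ t)
        · have : deriv (ψ ∘ γ) t = 0 := by
            have h : (ψ ∘ γ) =ᶠ[𝓝 t] fun _ => ψ (γ t) := ht.continuousAt.eventually hconst
            rw [h.deriv_eq, deriv_const]
          simp [this]
        · have hmem : γ t ∈ U := (hU t htI).resolve_right hconst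
          rw [indicator_of_mem hmem, Pi.one_apply, one_mul]
          have := norm_deriv_lipschitz_comp_le hψ ht
          rw [← coe_nnnorm, ← coe_nnnorm, ← NNReal.coe_mul, NNReal.coe_le_coe] at this
          rw [enorm_eq_nnnorm]
          exact_mod_cast this
    _ = _ := by
        rw [restrict_Ioo_eq_restrict_Icc, lintegral_const_mul' _ _ ENNReal.coe_ne_top]

lemma Complex.det_mul (v : ℂ) : (ContinuousLinearMap.mul ℝ ℂ v).det = ‖v‖ ^ 2 := by
  have := Algebra.norm_complex_apply v
  rw [Algebra.norm_apply, Complex.normSq_eq_norm_sq] at this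
  exact this

lemma lintegral_comp_add_mul (w : ℂ) {v : ℂ} (hv : v ≠ 0) (H : ℂ → ℝ≥0∞) :
    ENNReal.ofReal (‖v‖ ^ 2) * ∫⁻ x : ℂ, H (w + x * v) = ∫⁻ x, H x := by
  have hder : ∀ x ∈ (univ : Set ℂ), HasFDerivWithinAt (fun x => w + x * v)
      (ContinuousLinearMap.mul ℝ ℂ v) univ x := by
    intro x _
    have := ((ContinuousLinearMap.mul ℝ ℂ v).hasFDerivAt (x := x)).const_add w
    simpa [mul_comm] using this.hasFDerivWithinAt (s := univ)
  have hinj : InjOn (fun x => w + x * v) univ := by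
    intro x _ y _ h
    simpa [hv] using h
  have himg : (fun x => w + x * v) '' univ = univ := by
    refine image_univ_of_surjective fun y => ⟨(y - w) / v, ?_⟩
    field_simp
    ring
  have := lintegral_image_eq_lintegral_abs_det_fderiv_mul volume MeasurableSet.univ hder hinj H
  rw [himg, Complex.det_mul] at this
  simp only [Measure.restrict_univ] at this
  rw [this, lintegral_const_mul' _ _ ENNReal.ofReal_ne_top, abs_of_nonneg (by positivity)]

lemma ofReal_mul_lintegral_comp_mul {c : ℝ} (hc : 0 < c) (H : ℝ → ℝ≥0∞) (hH : Measurable H) :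
    ENNReal.ofReal c * ∫⁻ s, H (s * c) = ∫⁻ y, H y := by
  have h := Real.smul_map_volume_mul_right hc.ne'
  rw [abs_of_pos hc] at h
  conv_rhs => rw [← h]
  rw [lintegral_smul_measure, lintegral_map hH (by fun_prop), smul_eq_mul]

/-- The path `t ↦ w + (t + i s m(t)) v`; for `|s| ≤ 1` these sweep out a neighbourhood of the
segment from `w` to `w + v`. -/
def sweepPath (w v : ℂ) (m : ℝ → ℝ) (s t : ℝ) : ℂ :=
  w + ((t : ℂ) + (s * m t : ℝ) * I) * v

lemma measurable_sweepPath (w v : ℂ) {m : ℝ → ℝ} (hm : Measurable m) :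
    Measurable fun z : ℝ × ℝ => sweepPath w v m z.1 z.2 := by
  unfold sweepPath
  fun_prop

lemma lintegral_sweepPath_le (w : ℂ) {v : ℂ} (hv : v ≠ 0) {m : ℝ → ℝ} (hm : Measurable m)
    (hpos : ∀ t ∈ Ioo (0 : ℝ) 1, 0 < m t) {H : ℂ → ℝ≥0∞} (hH : Measurable H) :
    ENNReal.ofReal (‖v‖ ^ 2) * ∫⁻ z, H (sweepPath w v m z.1 z.2) * ENNReal.ofReal (m z.2)
        ∂((volume.restrict (Icc (-1 : ℝ) 1)).prod (volume.restrict (Ioo (0 : ℝ) 1))) ≤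
      ∫⁻ x, H x := by
  have hmeas : Measurable fun z : ℝ × ℝ =>
      H (sweepPath w v m z.1 z.2) * ENNReal.ofReal (m z.2) :=
    (hH.comp (measurable_sweepPath w v hm)).mul (by fun_prop)
  have hmeas' : Measurable fun z : ℝ × ℝ => H (w + ((z.1 : ℂ) + z.2 * I) * v) :=
    hH.comp (by fun_prop)
  rw [← lintegral_comp_add_mul w hv H]
  gcongr
  rw [lintegral_prod_symm _ hmeas.aemeasurable,
    ← (Complex.volume_preserving_equiv_real_prod.symm).lintegral_comp_emb
      (MeasurableEquiv.measurableEmbedding _), Measure.volume_eq_prod, lintegral_prod]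
  · refine (setLIntegral_mono' measurableSet_Ioo fun t ht => ?_).trans
      (setLIntegral_le_lintegral _ _)
    have hsec : Measurable fun y : ℝ => H (w + ((t : ℂ) + y * I) * v) :=
      hmeas'.comp (measurable_const.prodMk measurable_id)
    have h := ofReal_mul_lintegral_comp_mul (hpos t ht) _ hsec
    have hsymm : ∀ y : ℝ, (measurableEquivRealProd.symm (t, y) : ℂ) = (t : ℂ) + y * I := fun y => by
      apply Complex.ext <;> simp [measurableEquivRealProd]
    simp only [hsymm]
    rw [← h, mul_comm, ← lintegral_mul_const' _ _ ENNReal.ofReal_ne_top]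
    exact setLIntegral_le_lintegral _ _
  · refine Measurable.aemeasurable ?_
    exact hH.comp (by fun_prop)

lemma two_rpow_mul_le_of_one_le_lintegral_sweepPath {p : ℝ} (hp : 2 < p) (w : ℂ) {v : ℂ}
    (hv : v ≠ 0) {m : ℝ → ℝ} (hm : Measurable m) (hpos : ∀ t ∈ Ioo (0 : ℝ) 1, 0 < m t)
    {ρ : ℂ → ℝ≥0∞} (hρ : Measurable ρ) (Λ : ℝ≥0∞)
    (h : ∀ s ∈ Icc (-1 : ℝ) 1, 1 ≤ ∫⁻ t in Ioo (0 : ℝ) 1, ρ (sweepPath w v m s t) * Λ) :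
    2 ^ p * ENNReal.ofReal (‖v‖ ^ 2) ≤
      (Λ ^ p * ∫⁻ z, ρ z ^ p) *
        (2 * ∫⁻ t in Ioo (0 : ℝ) 1, ENNReal.ofReal (m t) ^ (-1 / (p - 1))) ^ (p - 1) := by
  have hp0 : 0 < p := by linarith
  have hp1 : p - 1 ≠ 0 := by linarith
  set μ : Measure (ℝ × ℝ) :=
    (volume.restrict (Icc (-1 : ℝ) 1)).prod (volume.restrict (Ioo (0 : ℝ) 1)) with hμ
  set q := p / (p - 1) with hq
  have hpq : p.HolderConjugate q := Real.HolderConjugate.conjExponent (by linarith)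
  set F : ℝ × ℝ → ℝ≥0∞ := fun z => ρ (sweepPath w v m z.1 z.2) with hF
  have hFm : Measurable F := hρ.comp (measurable_sweepPath w v hm)
  set M : ℝ × ℝ → ℝ≥0∞ := fun z => ENNReal.ofReal (m z.2) with hM
  have hMm : Measurable M := by fun_prop
  have hMpos : ∀ᵐ z ∂μ, M z ≠ 0 := by
    have : ∀ᵐ t ∂(volume.restrict (Ioo (0 : ℝ) 1)), ENNReal.ofReal (m t) ≠ 0 := by
      filter_upwards [ae_restrict_mem measurableSet_Ioo] with t ht
      simpa using hpos t ht
    exact Measure.quasiMeasurePreserving_snd.ae this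
  have h2 : (2 : ℝ≥0∞) ≤ Λ * ∫⁻ z, F z ∂μ := by
    calc (2 : ℝ≥0∞) = ∫⁻ s in Icc (-1 : ℝ) 1, 1 := by
          rw [setLIntegral_one, Real.volume_Icc]; norm_num
      _ ≤ ∫⁻ s in Icc (-1 : ℝ) 1, ∫⁻ t in Ioo (0 : ℝ) 1, F (s, t) * Λ :=
          setLIntegral_mono' measurableSet_Icc h
      _ = ∫⁻ z, F z * Λ ∂μ := (lintegral_prod _ (hFm.mul_const Λ).aemeasurable).symm
      _ = Λ * ∫⁻ z, F z ∂μ := by rw [lintegral_mul_const _ hFm, mul_comm]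
  have hA : ENNReal.ofReal (‖v‖ ^ 2) * ∫⁻ z, F z ^ p * M z ∂μ ≤ ∫⁻ z, ρ z ^ p :=
    lintegral_sweepPath_le w hv hm hpos (H := fun z => ρ z ^ p) (hρ.pow_const p)
  have hB : ∫⁻ z, M z ^ (-1 / (p - 1)) ∂μ =
      2 * ∫⁻ t in Ioo (0 : ℝ) 1, ENNReal.ofReal (m t) ^ (-1 / (p - 1)) := by
    rw [hμ, lintegral_prod _ (hMm.pow_const _).aemeasurable]
    simp only [hM]
    rw [setLIntegral_const, Real.volume_Icc, mul_comm]
    norm_num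
  have hHolder : ∫⁻ z, F z ∂μ ≤
      (∫⁻ z, F z ^ p * M z ∂μ) ^ (1 / p) * (∫⁻ z, M z ^ (-1 / (p - 1)) ∂μ) ^ (1 / q) := by
    have h1 := ENNReal.lintegral_mul_le_Lp_mul_Lq μ hpq
      (f := fun z => F z * M z ^ (1 / p)) (g := fun z => M z ^ (-(1 / p)))
      (hFm.mul (hMm.pow_const _)).aemeasurable (hMm.pow_const _).aemeasurable
    calc ∫⁻ z, F z ∂μ = ∫⁻ z, ((fun z => F z * M z ^ (1 / p)) * fun z => M z ^ (-(1 / p))) z ∂μ := by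
          refine lintegral_congr_ae ?_
          filter_upwards [hMpos] with z hz
          rw [Pi.mul_apply, mul_assoc, ← ENNReal.rpow_add _ _ hz ENNReal.ofReal_ne_top]
          simp
      _ ≤ _ := h1
      _ = _ := by
          have e1 : ∀ z, (F z * M z ^ (1 / p)) ^ p = F z ^ p * M z := fun z => by
            rw [ENNReal.mul_rpow_of_nonneg _ _ hp0.le, ← ENNReal.rpow_mul,
              one_div_mul_cancel hp0.ne', ENNReal.rpow_one]
          have e2 : ∀ z, (M z ^ (-(1 / p))) ^ q = M z ^ (-1 / (p - 1)) := fun z => by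
            rw [← ENNReal.rpow_mul, hq]
            congr 1
            field_simp
          simp only [e1, e2]
  have h3 : (2 : ℝ≥0∞) ^ p ≤ Λ ^ p * ((∫⁻ z, F z ^ p * M z ∂μ) *
      (2 * ∫⁻ t in Ioo (0 : ℝ) 1, ENNReal.ofReal (m t) ^ (-1 / (p - 1))) ^ (p - 1)) := by
    rw [← hB]
    calc (2 : ℝ≥0∞) ^ p ≤ (Λ * ((∫⁻ z, F z ^ p * M z ∂μ) ^ (1 / p) *
          (∫⁻ z, M z ^ (-1 / (p - 1)) ∂μ) ^ (1 / q))) ^ p := by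
          gcongr
          exact h2.trans (by gcongr)
      _ = _ := by
          have e : 1 / q * p = p - 1 := by rw [hq]; field_simp
          rw [ENNReal.mul_rpow_of_nonneg _ _ hp0.le, ENNReal.mul_rpow_of_nonneg _ _ hp0.le,
            ← ENNReal.rpow_mul, ← ENNReal.rpow_mul, one_div_mul_cancel hp0.ne', ENNReal.rpow_one, e]
  calc 2 ^ p * ENNReal.ofReal (‖v‖ ^ 2) ≤ (Λ ^ p * ((∫⁻ z, F z ^ p * M z ∂μ) *
      (2 * ∫⁻ t in Ioo (0 : ℝ) 1, ENNReal.ofReal (m t) ^ (-1 / (p - 1))) ^ (p - 1))) *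
        ENNReal.ofReal (‖v‖ ^ 2) := by gcongr
    _ = (Λ ^ p * (ENNReal.ofReal (‖v‖ ^ 2) * ∫⁻ z, F z ^ p * M z ∂μ)) *
        (2 * ∫⁻ t in Ioo (0 : ℝ) 1, ENNReal.ofReal (m t) ^ (-1 / (p - 1))) ^ (p - 1) := by ring
    _ ≤ _ := by gcongr

lemma isAdmissible_indicator_const {Γ : Set (ℝ → ℂ)} {ψ : ℂ → ℝ} {C : ℝ≥0}
    (hψ : LipschitzWith C ψ) {U : Set ℂ} (hUm : MeasurableSet U) {δ : ℝ} (hδ : 0 < δ)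
    (hU : ∀ γ ∈ Γ, ∀ t ∈ Ioo (0 : ℝ) 1, γ t ∈ U ∨ ∀ᶠ z in 𝓝 (γ t), ψ z = ψ (γ t))
    (hvar : ∀ γ ∈ Γ, δ ≤ ψ (γ 1) - ψ (γ 0)) :
    IsAdmissible (U.indicator fun _ => ENNReal.ofReal (C / δ)) Γ := by
  refine ⟨measurable_const.indicator hUm, fun γ hγ => ?_⟩
  unfold lineIntegral
  split_ifs with hlip
  · obtain ⟨L, hL⟩ := hlip
    have h := (ENNReal.ofReal_le_ofReal (hvar γ hγ)).trans
      (ofReal_sub_le_lintegral_indicator hψ hL (hU γ hγ))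
    have e : ∀ t, U.indicator (fun _ => ENNReal.ofReal (C / δ)) (γ t) * (‖deriv γ t‖₊ : ℝ≥0∞) =
        ENNReal.ofReal (C / δ) * (U.indicator 1 (γ t) * (‖deriv γ t‖₊ : ℝ≥0∞)) := fun t => by
      by_cases ht : γ t ∈ U <;> simp [ht]
    simp only [e]
    rw [lintegral_const_mul' _ _ ENNReal.ofReal_ne_top, div_eq_inv_mul,
      ENNReal.ofReal_mul (by positivity), ENNReal.ofReal_coe_nnreal, mul_assoc]
    calc (1 : ℝ≥0∞) = ENNReal.ofReal δ⁻¹ * ENNReal.ofReal δ := by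
          rw [← ENNReal.ofReal_mul (by positivity), inv_mul_cancel₀ hδ.ne', ENNReal.ofReal_one]
      _ ≤ _ := by gcongr
  · exact le_top

lemma lineIntegral_le_of_eqOn {ρ : ℂ → ℝ≥0∞} {γ γ₀ : ℝ → ℂ} (heq : EqOn γ γ₀ (Icc 0 1))
    {L : ℝ≥0} (hL : LipschitzOnWith L γ₀ (Icc 0 1)) :
    lineIntegral ρ γ ≤ ∫⁻ t in Ioo (0 : ℝ) 1, ρ (γ₀ t) * L := by
  have hL' : LipschitzOnWith L γ (Icc 0 1) := fun x hx y hy => by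
    rw [heq hx, heq hy]; exact hL hx hy
  unfold lineIntegral
  rw [if_pos ⟨L, hL'⟩, ← restrict_Ioo_eq_restrict_Icc]
  refine setLIntegral_mono' measurableSet_Ioo fun t ht => ?_
  have := norm_deriv_le_of_lipschitzOn (Icc_mem_nhds ht.1 ht.2) hL'
  rw [heq (Ioo_subset_Icc_self ht)]
  gcongr
  exact_mod_cast this

/-- The basic inequality for a `Q`-homeomorphism with `Q ≤ K`: the modulus of the sweeping
family in the image, estimated from below, is at most the modulus of its preimage, estimated
from above by a density constant on `U`. -/
lemma IsQHomeo.sweepPath_inequality {p : ℝ} (hp : 2 < p) {D D' : Set ℂ} {Q : ℂ → ℝ≥0∞}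
    {f g : ℂ → ℂ} (hf : IsQHomeo p D Q f) {K : ℝ} (hK : 0 < K)
    (hQK : ∀ᵐ z ∂(volume.restrict D), Q z ≤ ENNReal.ofReal K)
    (hg : ContinuousOn g D') (hgD : ∀ w ∈ D', g w ∈ D) (hfg : ∀ w ∈ D', f (g w) = w)
    {w v : ℂ} (hv : v ≠ 0) {m : ℝ → ℝ} (hm : Measurable m)
    (hpos : ∀ t ∈ Ioo (0 : ℝ) 1, 0 < m t) {L : ℝ≥0} (hL0 : 0 < L)
    (hL : ∀ s ∈ Icc (-1 : ℝ) 1, LipschitzOnWith L (sweepPath w v m s) (Icc 0 1))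
    (hmem : ∀ s ∈ Icc (-1 : ℝ) 1, ∀ t ∈ Icc (0 : ℝ) 1, sweepPath w v m s t ∈ D')
    {ψ : ℂ → ℝ} {C : ℝ≥0} (hψ : LipschitzWith C ψ) {U : Set ℂ} (hUm : MeasurableSet U)
    (hU : ∀ s ∈ Icc (-1 : ℝ) 1, ∀ t ∈ Ioo (0 : ℝ) 1, g (sweepPath w v m s t) ∈ U ∨
      ∀ᶠ z in 𝓝 (g (sweepPath w v m s t)), ψ z = ψ (g (sweepPath w v m s t)))
    {δ : ℝ} (hδ : 0 < δ) (hvar : ∀ s ∈ Icc (-1 : ℝ) 1,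
      δ ≤ ψ (g (sweepPath w v m s 1)) - ψ (g (sweepPath w v m s 0)))
    {V : ℝ} (hV0 : 0 ≤ V) (hV : volume U ≤ ENNReal.ofReal V) {J : ℝ} (hJ0 : 0 < J)
    (hJ : ∫⁻ t in Ioo (0 : ℝ) 1, ENNReal.ofReal (m t) ^ (-1 / (p - 1)) ≤ ENNReal.ofReal J) :
    2 ^ p * ‖v‖ ^ 2 ≤ L ^ p * (K * V * (C / δ) ^ p) * (2 * J) ^ (p - 1) := by
  have hp0 : 0 < p := by linarith
  set Γ : Set (ℝ → ℂ) := (fun s => g ∘ sweepPath w v m s) '' Icc (-1 : ℝ) 1 with hΓ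
  have hΓD : CurveFamilyIn Γ D := by
    rintro _ ⟨s, hs, rfl⟩
    exact ⟨hg.comp (hL s hs).continuousOn (hmem s hs), fun t ht => hgD _ (hmem s hs t ht)⟩
  have hadm : IsAdmissible (U.indicator fun _ => ENNReal.ofReal (C / δ)) Γ := by
    refine isAdmissible_indicator_const hψ hUm hδ ?_ ?_
    · rintro _ ⟨s, hs, rfl⟩
      exact hU s hs
    · rintro _ ⟨s, hs, rfl⟩
      exact hvar s hs
  have hupper : pModulus p ((fun γ => f ∘ γ) '' Γ) ≤ ENNReal.ofReal (K * V * (C / δ) ^ p) := by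
    refine (hf.2 Γ hΓD _ hadm).trans ?_
    calc ∫⁻ z in D, Q z * U.indicator (fun _ => ENNReal.ofReal (C / δ)) z ^ p
        ≤ ∫⁻ z in D, U.indicator
            (fun _ => ENNReal.ofReal K * ENNReal.ofReal ((C / δ) ^ p)) z := by
          refine lintegral_mono_ae ?_
          filter_upwards [hQK] with z hz
          by_cases hzU : z ∈ U
          · simp only [indicator_of_mem hzU]
            rw [ENNReal.ofReal_rpow_of_nonneg (by positivity) hp0.le]
            gcongr
          · simp [hzU, hp0]
      _ ≤ ∫⁻ z, U.indicator (fun _ => ENNReal.ofReal K * ENNReal.ofReal ((C / δ) ^ p)) z :=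
          setLIntegral_le_lintegral _ _
      _ ≤ ENNReal.ofReal K * ENNReal.ofReal ((C / δ) ^ p) * ENNReal.ofReal V := by
          rw [lintegral_indicator_const hUm]
          gcongr
      _ = _ := by
          rw [← ENNReal.ofReal_mul hK.le, ← ENNReal.ofReal_mul (by positivity)]
          congr 1
          ring
  set a : ℝ := L ^ p * (2 * J) ^ (p - 1) with ha
  have ha0 : 0 < a := by positivity
  have hlower : 2 ^ p * ENNReal.ofReal (‖v‖ ^ 2) / ENNReal.ofReal a ≤
      pModulus p ((fun γ => f ∘ γ) '' Γ) := by
    refine le_iInf₂ fun ρ hρ => ENNReal.div_le_of_le_mul' ?_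
    refine (two_rpow_mul_le_of_one_le_lintegral_sweepPath hp w hv hm hpos hρ.1 (L : ℝ≥0∞)
      fun s hs => ?_).trans ?_
    · refine (hρ.2 _ ⟨_, ⟨s, hs, rfl⟩, rfl⟩).trans (lineIntegral_le_of_eqOn ?_ (hL s hs))
      exact fun t ht => hfg _ (hmem s hs t ht)
    · rw [ha, ENNReal.ofReal_mul (by positivity),
        ← ENNReal.ofReal_rpow_of_nonneg (by positivity) hp0.le,
        ← ENNReal.ofReal_rpow_of_nonneg (by positivity) (by linarith),
        ENNReal.ofReal_coe_nnreal, ENNReal.ofReal_mul zero_le_two, ENNReal.ofReal_ofNat,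
        mul_right_comm]
      gcongr
      linarith
  have h := (ENNReal.div_le_iff' (by simpa using ha0) ENNReal.ofReal_ne_top).1
    (hlower.trans hupper)
  rw [← ENNReal.ofReal_mul ha0.le, ← ENNReal.ofReal_ofNat,
    ENNReal.ofReal_rpow_of_nonneg (by positivity) hp0.le, ← ENNReal.ofReal_mul (by positivity),
    ENNReal.ofReal_le_ofReal_iff (by positivity)] at h
  linarith

lemma lipschitzWith_sweepPath (w v : ℂ) {m : ℝ → ℝ} {c : ℝ≥0} (hm : LipschitzWith c m) {s : ℝ}
    (hs : s ∈ Icc (-1 : ℝ) 1) : LipschitzWith ((1 + c) * ‖v‖₊) (sweepPath w v m s) := by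
  refine LipschitzWith.of_dist_le_mul fun x y => ?_
  have h1 := hm.dist_le_mul x y
  rw [Real.dist_eq, Real.dist_eq] at h1
  have e : sweepPath w v m s x - sweepPath w v m s y =
      (((x - y : ℝ) : ℂ) + ((s * (m x - m y) : ℝ) : ℂ) * I) * v := by
    simp only [sweepPath]
    push_cast
    ring
  rw [dist_eq_norm, e, norm_mul, Real.dist_eq]
  rw [NNReal.coe_mul, NNReal.coe_add, NNReal.coe_one, coe_nnnorm]
  calc _ ≤ (|x - y| + c * |x - y|) * ‖v‖ := by
        gcongr
        refine (norm_add_le _ _).trans ?_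
        rw [norm_mul, norm_I, mul_one]
        simp only [Complex.norm_real, Real.norm_eq_abs, abs_mul]
        refine add_le_add le_rfl ?_
        calc |s| * |m x - m y| ≤ 1 * |m x - m y| := by
              gcongr
              exact abs_le.2 hs
          _ ≤ _ := by rw [one_mul]; exact h1
    _ = _ := by ring

lemma exists_lintegral_min_rpow_le {p : ℝ} (hp : 2 < p) : ∃ J : ℝ, 0 < J ∧
    ∫⁻ t in Ioo (0 : ℝ) 1, ENNReal.ofReal (min t (1 - t)) ^ (-1 / (p - 1)) ≤
      ENNReal.ofReal J := by
  set a := -1 / (p - 1) with ha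
  have ha1 : -1 < a := by
    rw [ha, lt_div_iff₀ (by linarith)]; linarith
  have h0 : IntervalIntegrable (fun t : ℝ => t ^ a) volume 0 1 :=
    intervalIntegral.intervalIntegrable_rpow' ha1
  have h1 : IntervalIntegrable (fun t : ℝ => (1 - t) ^ a) volume 0 1 := by
    simpa using (h0.comp_sub_left 1).symm
  have hint : IntegrableOn (fun t : ℝ => t ^ a + (1 - t) ^ a) (Ioo 0 1) :=
    ((intervalIntegrable_iff_integrableOn_Ioo_of_le zero_le_one).1 (h0.add h1))
  have hfin := hint.lintegral_lt_top
  refine ⟨(∫⁻ t in Ioo (0 : ℝ) 1, ENNReal.ofReal (t ^ a + (1 - t) ^ a)).toReal + 1,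
    by positivity, ?_⟩
  calc _ ≤ ∫⁻ t in Ioo (0 : ℝ) 1, ENNReal.ofReal (t ^ a + (1 - t) ^ a) := by
        refine setLIntegral_mono' measurableSet_Ioo fun t ht => ?_
        have ht0 : 0 < t := ht.1
        have ht1 : 0 < 1 - t := by linarith [ht.2]
        rw [ENNReal.ofReal_rpow_of_pos (lt_min ht0 ht1)]
        refine ENNReal.ofReal_le_ofReal ?_
        have := Real.rpow_pos_of_pos ht0 a
        have := Real.rpow_pos_of_pos ht1 a
        rcases min_choice t (1 - t) with h | h <;> rw [h] <;> linarith
    _ = ENNReal.ofReal (∫⁻ t in Ioo (0 : ℝ) 1, ENNReal.ofReal (t ^ a + (1 - t) ^ a)).toReal :=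
        (ENNReal.ofReal_toReal hfin.ne).symm
    _ ≤ _ := ENNReal.ofReal_le_ofReal (by linarith)

/-- For `p > 2`, the inverse of a `Q`-homeomorphism with `Q ≤ K` is locally Lipschitz, with a
uniform constant. -/
lemma IsQHomeo.exists_norm_inverse_sub_le {p : ℝ} (hp : 2 < p) {D D' : Set ℂ} {Q : ℂ → ℝ≥0∞}
    {f g : ℂ → ℂ} (hf : IsQHomeo p D Q f) {K : ℝ} (hK : 0 < K)
    (hQK : ∀ᵐ z ∂(volume.restrict D), Q z ≤ ENNReal.ofReal K)
    (hg : ContinuousOn g D') (hgD : ∀ w ∈ D', g w ∈ D) (hfg : ∀ w ∈ D', f (g w) = w) :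
    ∃ c : ℝ≥0, ∀ w v : ℂ, closedBall w (2 * ‖v‖) ⊆ D' → ‖g (w + v) - g w‖ ≤ c * ‖v‖ := by
  obtain ⟨J, hJ0, hJ⟩ := exists_lintegral_min_rpow_le hp
  set c : ℝ := (K * Real.pi * (2 * J) ^ (p - 1)) ^ (1 / (p - 2)) with hc
  have hπ := Real.pi_pos
  have hc0 : 0 ≤ c := by positivity
  refine ⟨⟨c, hc0⟩, fun w v hball => ?_⟩
  rcases eq_or_ne v 0 with rfl | hv
  · simp
  have hv0 : 0 < ‖v‖ := norm_pos_iff.2 hv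
  set R := ‖g (w + v) - g w‖ with hR
  rcases (norm_nonneg (g (w + v) - g w)).eq_or_lt with hR0 | hR0
  · rw [hR, ← hR0]
    exact mul_nonneg hc0 hv0.le
  rw [← hR] at hR0
  set m : ℝ → ℝ := fun t => min t (1 - t) with hm
  have hm1 : LipschitzWith 1 m := by
    have := LipschitzWith.id.min ((LipschitzWith.const (α := ℝ) (1 : ℝ)).sub LipschitzWith.id)
    simpa using this
  have hpath0 : ∀ s, sweepPath w v m s 0 = w := fun s => by simp [sweepPath, hm]
  have hpath1 : ∀ s, sweepPath w v m s 1 = w + v := fun s => by simp [sweepPath, hm]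
  have key := hf.sweepPath_inequality hp hK hQK hg hgD hfg hv hm1.continuous.measurable
    (w := w) (L := 2 * ‖v‖₊) (ψ := fun z => min (dist z (g w)) R) (C := 1)
    (U := closedBall (g w) R) (δ := R) (V := R ^ 2 * Real.pi) (J := J)
    (fun t ht => lt_min ht.1 (by linarith [ht.2])) (by simpa using hv)
    (fun s hs => by
      simpa [one_add_one_eq_two] using (lipschitzWith_sweepPath w v hm1 hs).lipschitzOnWith)
    (fun s hs t ht => hball ?_) ((LipschitzWith.dist_left _).min_const _)
    measurableSet_closedBall (fun s hs t ht => ?_) hR0 (fun s hs => ?_) (by positivity) ?_ hJ0 hJ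
  · have h1 : 2 ^ p * ‖v‖ ^ 2 ≤
        2 ^ p * (‖v‖ ^ p * (K * Real.pi * (2 * J) ^ (p - 1)) * (R ^ 2 / R ^ p)) := by
      refine key.trans_eq ?_
      push_cast
      rw [Real.mul_rpow zero_le_two (norm_nonneg _), Real.div_rpow zero_le_one hR0.le,
        Real.one_rpow]
      ring
    have h2 := le_of_mul_le_mul_left h1 (by positivity)
    have e1 : R ^ p = R ^ 2 * R ^ (p - 2) := by
      rw [← Real.rpow_natCast, ← Real.rpow_add hR0]; norm_num
    have e2 : ‖v‖ ^ p = ‖v‖ ^ 2 * ‖v‖ ^ (p - 2) := by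
      rw [← Real.rpow_natCast, ← Real.rpow_add hv0]; norm_num
    have h3 : R ^ (p - 2) ≤ (K * Real.pi * (2 * J) ^ (p - 1)) * ‖v‖ ^ (p - 2) := by
      have hRp : 0 < R ^ (p - 2) := by positivity
      have e3 : R ^ 2 / R ^ p = (R ^ (p - 2))⁻¹ := by rw [e1]; field_simp
      rw [e2, e3, ← div_eq_mul_inv, le_div_iff₀ hRp] at h2
      have : 0 < ‖v‖ ^ 2 := by positivity
      nlinarith
    have hp2 : 0 < p - 2 := by linarith
    have h4 : R ^ (p - 2) ≤ (c * ‖v‖) ^ (p - 2) := by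
      rw [Real.mul_rpow hc0 hv0.le, hc, ← Real.rpow_mul (by positivity),
        one_div_mul_cancel hp2.ne', Real.rpow_one]
      exact h3
    exact (Real.rpow_le_rpow_iff hR0.le (by positivity) hp2).1 h4
  · rw [mem_closedBall, dist_eq_norm]
    have := (lipschitzWith_sweepPath w v hm1 hs).dist_le_mul t 0
    rw [hpath0, dist_eq_norm, Real.dist_eq, sub_zero, abs_of_nonneg ht.1] at this
    push_cast at this
    nlinarith [ht.2]
  · by_cases h : g (sweepPath w v m s t) ∈ closedBall (g w) R
    · exact Or.inl h
    · right
      filter_upwards [isClosed_closedBall.isOpen_compl.mem_nhds h] with z hz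
      rw [mem_compl_iff, mem_closedBall, not_le] at hz
      rw [mem_closedBall, not_le] at h
      rw [min_eq_right hz.le, min_eq_right h.le]
  · rw [hpath0, hpath1, dist_self, dist_eq_norm, ← hR, min_self, min_eq_left hR0.le, sub_zero]
  · rw [Complex.volume_closedBall, ENNReal.ofReal_mul (by positivity),
      ENNReal.ofReal_pow hR0.le]
    gcongr
    exact (ENNReal.ofReal_coe_nnreal (p := NNReal.pi)).ge

lemma Complex.exists_norm_add_conj_eq (a b : ℂ) :
    ∃ u : ℂ, ‖u‖ = 1 ∧ ‖a * u + b * conj u‖ = |‖a‖ - ‖b‖| := by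
  set x := arg a
  set y := arg b
  refine ⟨exp (((y - x + Real.pi) / 2 : ℝ) * I), norm_exp_ofReal_mul_I _, ?_⟩
  have ha : a = ‖a‖ * exp (x * I) := (norm_mul_exp_arg_mul_I a).symm
  have hb : b = ‖b‖ * exp (y * I) := (norm_mul_exp_arg_mul_I b).symm
  have e1 : exp (y * I) * conj (exp (((y - x + Real.pi) / 2 : ℝ) * I)) =
      -(exp (x * I) * exp (((y - x + Real.pi) / 2 : ℝ) * I)) := by
    rw [← exp_conj, ← Complex.exp_add, ← Complex.exp_add, ← mul_neg_one, ← exp_pi_mul_I,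
      ← Complex.exp_add, Complex.exp_eq_exp_iff_exists_int]
    refine ⟨-1, ?_⟩
    simp only [map_mul, conj_ofReal, conj_I]
    push_cast
    ring
  have e2 : a * exp (((y - x + Real.pi) / 2 : ℝ) * I) +
      b * conj (exp (((y - x + Real.pi) / 2 : ℝ) * I)) =
      ((‖a‖ - ‖b‖ : ℝ) : ℂ) * exp ((x : ℝ) * I) * exp (((y - x + Real.pi) / 2 : ℝ) * I) := by
    conv_lhs => rw [ha, hb]
    rw [mul_assoc (‖b‖ : ℂ), e1]
    push_cast
    ring
  rw [e2, norm_mul, norm_mul, norm_exp_ofReal_mul_I, norm_exp_ofReal_mul_I, Complex.norm_real]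
  simp

lemma Complex.det_eq_re_mul_im_sub (A : ℂ →L[ℝ] ℂ) :
    A.det = (A 1).re * (A I).im - (A I).re * (A 1).im := by
  change LinearMap.det (A : ℂ →ₗ[ℝ] ℂ) = _
  rw [← LinearMap.det_toMatrix basisOneI, Matrix.det_fin_two]
  simp [LinearMap.toMatrix_apply]

lemma Complex.map_eq_re_add_im (A : ℂ →L[ℝ] ℂ) (u : ℂ) : A u = u.re * A 1 + u.im * A I := by
  conv_lhs => rw [← re_add_im u]
  have h1 : A (u.re : ℂ) = u.re * A 1 := by
    have := A.map_smul u.re 1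
    simpa using this
  have h2 : A (u.im * I) = u.im * A I := by
    have := A.map_smul u.im I
    simpa using this
  rw [map_add, h1, h2]

/-- A real-linear map of the plane contracts some direction at least by the square root of its
Jacobian. -/
lemma Complex.exists_norm_sq_map_le_abs_det (A : ℂ →L[ℝ] ℂ) :
    ∃ u : ℂ, ‖u‖ = 1 ∧ ‖A u‖ ^ 2 ≤ |A.det| := by
  set a : ℂ := (A 1 - I * A I) / 2 with ha
  set b : ℂ := (A 1 + I * A I) / 2 with hb
  obtain ⟨u, hu, h⟩ := exists_norm_add_conj_eq a b
  refine ⟨u, hu, ?_⟩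
  have hAu : A u = a * u + b * conj u := by
    rw [map_eq_re_add_im A u, ha, hb]
    apply Complex.ext <;> simp <;> ring
  have hdet : A.det = ‖a‖ ^ 2 - ‖b‖ ^ 2 := by
    rw [det_eq_re_mul_im_sub, ← normSq_eq_norm_sq, ← normSq_eq_norm_sq, normSq_apply, normSq_apply,
      ha, hb]
    simp
    ring
  rw [hAu, h, hdet, sq_sub_sq, abs_mul, sq, abs_of_nonneg (by positivity : 0 ≤ ‖a‖ + ‖b‖)]
  refine mul_le_mul_of_nonneg_right ?_ (abs_nonneg _)
  exact abs_le.2 ⟨by linarith [norm_nonneg a, norm_nonneg b],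
    by linarith [norm_nonneg a, norm_nonneg b]⟩

lemma Complex.volume_Icc_reProdIm_Icc (a b c d : ℝ) :
    volume (Icc a b ×ℂ Icc c d) = ENNReal.ofReal (b - a) * ENNReal.ofReal (d - c) := by
  have h := volume_preserving_equiv_real_prod.measure_preimage
    (s := Icc a b ×ˢ Icc c d) (measurableSet_Icc.prod measurableSet_Icc).nullMeasurableSet
  rw [Measure.volume_eq_prod, Measure.prod_prod, Real.volume_Icc, Real.volume_Icc] at h
  exact h

/-- Pairing with `A (I e)` under the area form reads off the first coordinate of `A (x e)`. -/
lemma Complex.im_conj_mul_map (A : ℂ →L[ℝ] ℂ) {e : ℂ} (he : ‖e‖ = 1) (x : ℂ) :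
    (conj (A (x * e)) * A (I * e)).im = x.re * A.det := by
  have h1 : e.re * e.re + e.im * e.im = 1 := by
    rw [← normSq_apply, normSq_eq_norm_sq, he, one_pow]
  rw [map_eq_re_add_im A (x * e), map_eq_re_add_im A (I * e), det_eq_re_mul_im_sub]
  simp
  linear_combination (x.re * ((A 1).re * (A I).im - (A I).re * (A 1).im)) * h1

lemma HasFDerivAt.exists_norm_symm_sub_le {g : ℂ → ℂ} {A : ℂ ≃L[ℝ] ℂ} {w : ℂ}
    (hA : HasFDerivAt g (A : ℂ →L[ℝ] ℂ) w) {η : ℝ} (hη : 0 < η) :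
    ∀ᶠ x in 𝓝 (0 : ℂ), ‖A.symm (g (w + x) - g w) - x‖ ≤ η * ‖x‖ := by
  set M := ‖(A.symm : ℂ →L[ℝ] ℂ)‖ + 1 with hM
  have hM0 : 0 < M := by positivity
  have ho := (hasFDerivAt_iff_isLittleO_nhds_zero.1 hA).def (div_pos hη hM0)
  filter_upwards [ho] with x hx
  have e : A.symm (g (w + x) - g w) - x = A.symm (g (w + x) - g w - A x) := by
    rw [map_sub A.symm _ (A x), A.symm_apply_apply]
  rw [e]
  calc _ ≤ ‖(A.symm : ℂ →L[ℝ] ℂ)‖ * ‖g (w + x) - g w - A x‖ :=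
        (A.symm : ℂ →L[ℝ] ℂ).le_opNorm _
    _ ≤ M * (η / M * ‖x‖) := by
        gcongr
        · linarith
        · exact hx
    _ = η * ‖x‖ := by field_simp

lemma IsQHomeo.one_le_parallelogram {p : ℝ} (hp : 2 < p) {D D' : Set ℂ} {Q : ℂ → ℝ≥0∞}
    {f g : ℂ → ℂ} (hf : IsQHomeo p D Q f) {K : ℝ} (hK : 0 < K)
    (hQK : ∀ᵐ z ∂(volume.restrict D), Q z ≤ ENNReal.ofReal K) (hD' : IsOpen D')
    (hg : ContinuousOn g D') (hgD : ∀ w ∈ D', g w ∈ D) (hfg : ∀ w ∈ D', f (g w) = w)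
    {w : ℂ} (hw : w ∈ D') {A : ℂ →L[ℝ] ℂ} (hA : HasFDerivAt g A w) (hd : A.det ≠ 0)
    {e : ℂ} (he : ‖e‖ = 1) {η : ℝ} (hη : 0 < η) (hη1 : η < 1 / 2) :
    1 ≤ K * |A.det| * ((1 + 2 * η) * (1 + η)) *
      (‖A (I * e)‖ / (|A.det| * (1 - 2 * η))) ^ p := by
  set A' := A.toContinuousLinearEquivOfDetNeZero hd with hA'
  have hAA' : (A' : ℂ →L[ℝ] ℂ) = A := A.coe_toContinuousLinearEquivOfDetNeZero hd
  have hd0 : 0 < |A.det| := abs_pos.2 hd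
  have happrox := HasFDerivAt.exists_norm_symm_sub_le (A := A') (hAA' ▸ hA) (half_pos hη)
  have hmemD : ∀ᶠ x in 𝓝 (0 : ℂ), w + x ∈ D' := by
    have : Tendsto (fun x : ℂ => w + x) (𝓝 0) (𝓝 w) := by
      simpa using (by fun_prop : Continuous fun x : ℂ => w + x).tendsto (0 : ℂ)
    exact this.eventually (hD'.mem_nhds hw)
  obtain ⟨R, hR0, hR⟩ := Metric.eventually_nhds_iff.1 (happrox.and hmemD)
  set h := R / 3 with hh
  have hh0 : 0 < h := by positivity
  set v : ℂ := h * e with hv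
  have hvn : ‖v‖ = h := by
    rw [hv, norm_mul, he, mul_one, Complex.norm_real, Real.norm_of_nonneg hh0.le]
  have hv0 : v ≠ 0 := norm_pos_iff.1 (hvn ▸ hh0)
  set m : ℝ → ℝ := fun _ => 1 with hm
  set y : ℝ → ℝ → ℂ := fun s t => A'.symm (g (sweepPath w v m s t) - g w) / v with hy
  have hpath : ∀ s t, sweepPath w v m s t = w + ((t : ℂ) + s * I) * v := fun s t => by
    simp [sweepPath, hm]
  have hsmall : ∀ s ∈ Icc (-1 : ℝ) 1, ∀ t ∈ Icc (0 : ℝ) 1, ‖((t : ℂ) + s * I)‖ ≤ 2 := by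
    intro s hs t ht
    refine (norm_add_le _ _).trans ?_
    rw [norm_mul, norm_I, mul_one, Complex.norm_real, Complex.norm_real, Real.norm_eq_abs,
      Real.norm_eq_abs, abs_of_nonneg ht.1]
    linarith [abs_le.2 hs, ht.2]
  have hin : ∀ s ∈ Icc (-1 : ℝ) 1, ∀ t ∈ Icc (0 : ℝ) 1,
      dist (((t : ℂ) + s * I) * v) 0 < R := by
    intro s hs t ht
    rw [dist_zero_right, norm_mul, hvn]
    nlinarith [hsmall s hs t ht]
  have hynear : ∀ s ∈ Icc (-1 : ℝ) 1, ∀ t ∈ Icc (0 : ℝ) 1, ‖y s t - (t + s * I)‖ ≤ η := by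
    intro s hs t ht
    have h1 := (hR (hin s hs t ht)).1
    have h2 := hsmall s hs t ht
    have e1 : y s t - (t + s * I) =
        (A'.symm (g (sweepPath w v m s t) - g w) - (t + s * I) * v) / v := by
      rw [hy]; field_simp
    rw [e1, hpath, norm_div, div_le_iff₀ (hvn ▸ hh0)]
    refine h1.trans ?_
    rw [norm_mul]
    have : 0 < ‖v‖ := hvn ▸ hh0
    calc η / 2 * (‖(t : ℂ) + s * I‖ * ‖v‖) ≤ η / 2 * (2 * ‖v‖) := by gcongr
      _ = η * ‖v‖ := by ring
  have hAy : ∀ s t, A (y s t * v) = g (sweepPath w v m s t) - g w := fun s t => by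
    rw [hy]
    simp only
    rw [div_mul_cancel₀ _ hv0, ← hAA']
    exact A'.apply_symm_apply _
  have hre : ∀ s ∈ Icc (-1 : ℝ) 1, ∀ t ∈ Icc (0 : ℝ) 1, |(y s t).re - t| ≤ η := by
    intro s hs t ht
    simpa using (abs_re_le_norm _).trans (hynear s hs t ht)
  have him : ∀ s ∈ Icc (-1 : ℝ) 1, ∀ t ∈ Icc (0 : ℝ) 1, |(y s t).im - s| ≤ η := by
    intro s hs t ht
    simpa using (abs_im_le_norm _).trans (hynear s hs t ht)
  set S : Set ℂ := Icc (-η) (1 + η) ×ℂ Icc (-(1 + η)) (1 + η) with hS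
  have hyS : ∀ s ∈ Icc (-1 : ℝ) 1, ∀ t ∈ Icc (0 : ℝ) 1, y s t ∈ S := by
    intro s hs t ht
    have h1 := abs_le.1 (hre s hs t ht)
    have h2 := abs_le.1 (him s hs t ht)
    rw [hS, mem_reProdIm]
    exact ⟨⟨by linarith [ht.1], by linarith [ht.2]⟩, ⟨by linarith [hs.1], by linarith [hs.2]⟩⟩
  set T : ℂ →L[ℝ] ℂ := A.comp (ContinuousLinearMap.mul ℝ ℂ v) with hT
  have hTdet : LinearMap.det (T : ℂ →ₗ[ℝ] ℂ) = A.det * h ^ 2 := by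
    rw [← hvn, ← Complex.det_mul v]
    exact LinearMap.det_comp _ _
  set U : Set ℂ := (fun z => z - g w) ⁻¹' (T '' S) with hU
  have hUm : MeasurableSet U :=
    (measurable_sub_const (g w))
      ((isCompact_Icc.reProdIm isCompact_Icc).image T.continuous).measurableSet
  have hUvol : volume U = ENNReal.ofReal (|A.det| * h ^ 2 * ((1 + 2 * η) * (2 + 2 * η))) := by
    have : volume U = volume (T '' S) := by
      simp only [hU, sub_eq_add_neg, measure_preimage_add_right]
    rw [this, Measure.addHaar_image_continuousLinearMap, hTdet, Complex.volume_Icc_reProdIm_Icc,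
      ← ENNReal.ofReal_mul (by linarith), ← ENNReal.ofReal_mul (by positivity), abs_mul,
      abs_of_pos (by positivity : 0 < h ^ 2)]
    congr 1
    ring
  set ψ : ℂ → ℝ := fun z => (conj (z - g w) * A (I * e)).im / (h * A.det) with hψ
  set C : ℝ≥0 := (‖A (I * e)‖ / (h * |A.det|)).toNNReal with hC
  have hCval : (C : ℝ) = ‖A (I * e)‖ / (h * |A.det|) := Real.coe_toNNReal _ (by positivity)
  have hψlip : LipschitzWith C ψ := by
    refine LipschitzWith.of_dist_le_mul fun a b => ?_
    have e1 : ψ a - ψ b = (conj (a - b) * A (I * e)).im / (h * A.det) := by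
      rw [hψ]
      simp only
      rw [← sub_div, ← sub_im, ← sub_mul, ← map_sub, sub_sub_sub_cancel_right]
    rw [Real.dist_eq, e1, abs_div, abs_mul, abs_of_pos hh0, hCval, dist_eq_norm,
      div_mul_eq_mul_div ‖A (I * e)‖]
    refine div_le_div_of_nonneg_right ?_ (by positivity)
    refine (abs_im_le_norm _).trans ?_
    rw [norm_mul, RCLike.norm_conj, mul_comm]
  have hψy : ∀ s t, ψ (g (sweepPath w v m s t)) = (y s t).re := by
    intro s t
    have e1 : y s t * v = (h * y s t) * e := by rw [hv]; ring
    simp only [hψ]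
    rw [← hAy, e1, Complex.im_conj_mul_map A he, re_ofReal_mul]
    field_simp
  have hJ : ∫⁻ t in Ioo (0 : ℝ) 1, ENNReal.ofReal (m t) ^ (-1 / (p - 1)) ≤ ENNReal.ofReal 1 := by
    simp [hm]
  have key := hf.sweepPath_inequality hp hK hQK hg hgD hfg hv0 (measurable_const (a := (1 : ℝ)))
    (fun _ _ => one_pos) (L := ‖v‖₊) (w := w) (by simpa using hv0)
    (fun s hs => by
      simpa using (lipschitzWith_sweepPath w v (LipschitzWith.const (1 : ℝ)) hs).lipschitzOnWith)
    (fun s hs t ht => by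
      have := (hR (hin s hs t ht)).2
      rwa [← hpath] at this) hψlip hUm
    (fun s hs t ht => Or.inl ⟨y s t, hyS s hs t (Ioo_subset_Icc_self ht), by
      change A (v * y s t) = _
      rw [mul_comm]
      exact hAy s t⟩) (δ := 1 - 2 * η) (by linarith)
    (fun s hs => by
      have h0 := abs_le.1 (hre s hs 0 (by simp))
      have h1 := abs_le.1 (hre s hs 1 (by simp))
      change 1 - 2 * η ≤ ψ (g (sweepPath w v m s 1)) - ψ (g (sweepPath w v m s 0))
      rw [hψy, hψy]
      linarith) (by positivity) hUvol.le one_pos hJ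
  have hδ0 : 0 < 1 - 2 * η := by linarith
  set X := ‖A (I * e)‖ / (|A.det| * (1 - 2 * η)) with hX
  have e1 : (C : ℝ) / (1 - 2 * η) = X / h := by
    rw [hCval, hX]; field_simp
  have hX0 : 0 ≤ X := by positivity
  have e2 : (2 : ℝ) ^ p = 2 * 2 ^ (p - 1) := by
    rw [Real.rpow_sub_one two_ne_zero]; ring
  rw [e1, coe_nnnorm, hvn, Real.div_rpow hX0 hh0.le, mul_one, e2] at key
  have hhp : 0 < h ^ p := by positivity
  have h2p : (0 : ℝ) < 2 ^ (p - 1) := by positivity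
  have key' : (2 * 2 ^ (p - 1) * h ^ 2) * 1 ≤ (2 * 2 ^ (p - 1) * h ^ 2) *
      (K * |A.det| * ((1 + 2 * η) * (1 + η)) * X ^ p) := by
    rw [mul_one]
    refine key.trans_eq ?_
    field_simp
  exact le_of_mul_le_mul_left key' (by positivity)

/-- The Jacobian of the inverse of a `Q`-homeomorphism with `Q ≤ K`. -/
lemma IsQHomeo.abs_det_fderiv_inverse_le {p : ℝ} (hp : 2 < p) {D D' : Set ℂ} {Q : ℂ → ℝ≥0∞}
    {f g : ℂ → ℂ} (hf : IsQHomeo p D Q f) {K : ℝ} (hK : 0 < K)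
    (hQK : ∀ᵐ z ∂(volume.restrict D), Q z ≤ ENNReal.ofReal K) (hD' : IsOpen D')
    (hg : ContinuousOn g D') (hgD : ∀ w ∈ D', g w ∈ D) (hfg : ∀ w ∈ D', f (g w) = w)
    {w : ℂ} (hw : w ∈ D') {A : ℂ →L[ℝ] ℂ} (hA : HasFDerivAt g A w) :
    |A.det| ≤ K ^ (2 / (p - 2)) := by
  by_cases hd : A.det = 0
  · rw [hd, abs_zero]; positivity
  obtain ⟨u, hu, hAu⟩ := Complex.exists_norm_sq_map_le_abs_det A
  set d := |A.det| with hdef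
  have hd0 : 0 < d := abs_pos.2 hd
  have he : ‖-I * u‖ = 1 := by simp [hu]
  have hIe : I * (-I * u) = u := by
    rw [← mul_assoc, mul_neg, I_mul_I, neg_neg, one_mul]
  have hlim : Tendsto (fun η : ℝ => K * d * ((1 + 2 * η) * (1 + η)) *
      (‖A u‖ / (d * (1 - 2 * η))) ^ p) (𝓝[>] 0) (𝓝 (K * d * (‖A u‖ / d) ^ p)) := by
    have hc : ContinuousAt (fun η : ℝ => K * d * ((1 + 2 * η) * (1 + η)) *
        (‖A u‖ / (d * (1 - 2 * η))) ^ p) 0 := by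
      refine ContinuousAt.mul (by fun_prop) (ContinuousAt.rpow_const ?_ (Or.inr (by linarith)))
      exact ContinuousAt.div (by fun_prop) (by fun_prop) (by simpa using hd0.ne')
    simpa using hc.tendsto.mono_left nhdsWithin_le_nhds
  have h1 : 1 ≤ K * d * (‖A u‖ / d) ^ p := by
    refine ge_of_tendsto hlim ?_
    filter_upwards [Ioo_mem_nhdsGT (by norm_num : (0 : ℝ) < 1 / 2)] with η hη
    have := hf.one_le_parallelogram hp hK hQK hD' hg hgD hfg hw hA hd he hη.1 hη.2
    rwa [hIe] at this
  have hp2 : 0 < p - 2 := by linarith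
  have h2 : ‖A u‖ ^ p ≤ d ^ (p / 2) := by
    have : ‖A u‖ ^ p = (‖A u‖ ^ 2) ^ (p / 2) := by
      rw [← Real.rpow_natCast, ← Real.rpow_mul (norm_nonneg _)]
      congr 1
      push_cast
      ring
    rw [this]
    gcongr
  have h3 : d ^ ((p - 2) / 2) ≤ K := by
    have e1 : d ^ p = d * d ^ (p / 2) * d ^ ((p - 2) / 2) := by
      nth_rewrite 2 [← Real.rpow_one d]
      rw [← Real.rpow_add hd0, ← Real.rpow_add hd0]
      congr 1
      ring
    rw [Real.div_rpow (norm_nonneg _) hd0.le, mul_div_assoc', le_div_iff₀ (by positivity),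
      one_mul] at h1
    have h4 : d * d ^ (p / 2) * d ^ ((p - 2) / 2) ≤ d * d ^ (p / 2) * K := by
      rw [← e1]
      calc d ^ p ≤ K * d * ‖A u‖ ^ p := h1
        _ ≤ K * d * d ^ (p / 2) := by gcongr
        _ = _ := by ring
    exact le_of_mul_le_mul_left h4 (by positivity)
  calc d = (d ^ ((p - 2) / 2)) ^ (2 / (p - 2)) := by
        rw [← Real.rpow_mul hd0.le]
        field_simp
        rw [Real.rpow_one]
    _ ≤ _ := by gcongr

/-- The image of the set of non-differentiability points of a locally Lipschitz map is null. -/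
lemma volume_image_not_differentiableAt_eq_zero {g : ℂ → ℂ} {s : Set ℂ}
    (hg : ∀ w ∈ s, ∃ c : ℝ≥0, ∃ U ∈ 𝓝 w, LipschitzOnWith c g U) :
    volume (g '' {w ∈ s | ¬DifferentiableAt ℝ g w}) = 0 := by
  set N := {w ∈ s | ¬DifferentiableAt ℝ g w} with hN
  have hloc : ∀ w ∈ N, ∃ V ∈ 𝓝 w, volume (g '' (N ∩ V)) = 0 := by
    intro w hw
    obtain ⟨c, U, hU, hc⟩ := hg w hw.1
    refine ⟨interior U, interior_mem_nhds.2 hU, ?_⟩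
    have h0 : volume (N ∩ interior U) = 0 := by
      refine measure_mono_null (fun x hx => ?_)
        (ae_iff.1 (hc.ae_differentiableWithinAt_of_mem (μ := volume)))
      intro h
      exact hx.1.2 ((h (interior_subset hx.2)).differentiableAt (mem_interior_iff_mem_nhds.1 hx.2))
    have h1 : μH[Module.finrank ℝ ℂ] (N ∩ interior U) = 0 :=
      Measure.absolutelyContinuous_isAddHaarMeasure _ volume h0
    refine Measure.absolutelyContinuous_isAddHaarMeasure _ (μH[Module.finrank ℝ ℂ]) ?_
    have h2 := (hc.mono (inter_subset_right.trans interior_subset : N ∩ interior U ⊆ U)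
      ).hausdorffMeasure_image_le (Nat.cast_nonneg (Module.finrank ℝ ℂ))
    rwa [h1, mul_zero, nonpos_iff_eq_zero] at h2
  choose! V hV hV0 using hloc
  obtain ⟨t, htN, htc, ht⟩ := TopologicalSpace.countable_cover_nhdsWithin
    (fun w (hw : w ∈ N) => mem_nhdsWithin_of_mem_nhds (hV w hw))
  refine measure_mono_null ?_ ((measure_biUnion_null_iff htc).2 fun w hw => hV0 w (htN hw))
  rintro _ ⟨x, hx, rfl⟩
  obtain ⟨w, hw, hxw⟩ := mem_iUnion₂.1 (ht hx)
  exact mem_iUnion₂.2 ⟨w, hw, x, ⟨hx, hxw⟩, rfl⟩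

lemma IsQHomeo.exists_lipschitzOnWith_inverse {p : ℝ} (hp : 2 < p) {D D' : Set ℂ}
    {Q : ℂ → ℝ≥0∞} {f g : ℂ → ℂ} (hf : IsQHomeo p D Q f) {K : ℝ} (hK : 0 < K)
    (hQK : ∀ᵐ z ∂(volume.restrict D), Q z ≤ ENNReal.ofReal K) (hD' : IsOpen D')
    (hg : ContinuousOn g D') (hgD : ∀ w ∈ D', g w ∈ D) (hfg : ∀ w ∈ D', f (g w) = w)
    {w : ℂ} (hw : w ∈ D') : ∃ c : ℝ≥0, ∃ U ∈ 𝓝 w, LipschitzOnWith c g U := by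
  obtain ⟨c, hc⟩ := hf.exists_norm_inverse_sub_le hp hK hQK hg hgD hfg
  obtain ⟨R, hR, hRD⟩ := Metric.isOpen_iff.1 hD' w hw
  refine ⟨c, ball w (R / 6), ball_mem_nhds w (by positivity),
    LipschitzOnWith.of_dist_le_mul fun a ha b hb => ?_⟩
  have hab : dist a b < R / 6 + R / 6 :=
    (dist_triangle_right a b w).trans_lt (add_lt_add ha hb)
  rw [dist_eq_norm] at hab
  have h := hc b (a - b) fun x hx => hRD ?_
  · rwa [add_sub_cancel, ← dist_eq_norm, ← dist_eq_norm] at h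
  · rw [mem_closedBall] at hx
    rw [mem_ball] at hb ⊢
    linarith [dist_triangle x b w]

/-- The inverse of a homeomorphism onto its image is continuous. -/
lemma IsHomeoOn.continuousOn_invFunOn {f : ℂ → ℂ} {D : Set ℂ} (hD : IsOpen D)
    (hf : IsHomeoOn f D) : ContinuousOn (Function.invFunOn f D) (f '' D) := by
  rintro _ ⟨z, hz, rfl⟩
  refine ContinuousAt.continuousWithinAt fun U hU => ?_
  rw [hf.2.1.leftInvOn_invFunOn hz] at hU
  obtain ⟨V, hVU, hVo, hzV⟩ := _root_.mem_nhds_iff.1 hU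
  refine mem_map.2 (mem_of_superset
    ((hf.2.2 (V ∩ D) inter_subset_right (hVo.inter hD)).mem_nhds ⟨z, ⟨hzV, hz⟩, rfl⟩) ?_)
  rintro _ ⟨x, hx, rfl⟩
  rw [mem_preimage, hf.2.1.leftInvOn_invFunOn hx.2]
  exact hVU hx.1

lemma closedBall_subset_of_lt_infDist_frontier {D : Set ℂ} (hD : IsOpen D) {z : ℂ} (hz : z ∈ D)
    {r : ℝ} (hr0 : 0 ≤ r) (hr : r < infDist z (frontier D)) : closedBall z r ⊆ D := by
  refine (convex_closedBall z r).isPreconnected.subset_left_of_subset_union hD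
    (isClosed_closure (s := D)).isOpen_compl
    (disjoint_compl_right.mono_left subset_closure |>.mono_right le_rfl) ?_
    ⟨z, mem_closedBall_self hr0, hz⟩
  intro x hx
  by_contra h
  rw [mem_union, not_or, mem_compl_iff, not_not] at h
  have hxf : x ∈ frontier D := by
    rw [hD.frontier_eq]
    exact ⟨h.2, h.1⟩
  have := infDist_le_dist_of_mem (x := z) hxf
  rw [mem_closedBall, dist_comm] at hx
  linarith

/-- A locally Lipschitz map whose Jacobian is at most `C` scales areas by at most `C`. -/
lemma volume_image_le_of_abs_det_le {g : ℂ → ℂ} {s F : Set ℂ} (hF : MeasurableSet F)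
    (hFs : F ⊆ s) (hg : ∀ w ∈ s, ∃ c : ℝ≥0, ∃ U ∈ 𝓝 w, LipschitzOnWith c g U) {C : ℝ}
    (hC : ∀ w ∈ s, ∀ A : ℂ →L[ℝ] ℂ, HasFDerivAt g A w → |A.det| ≤ C) :
    volume (g '' F) ≤ ENNReal.ofReal C * volume F := by
  set G := F ∩ {w | DifferentiableAt ℝ g w} with hG
  have hGm : MeasurableSet G := hF.inter (measurableSet_of_differentiableAt ℝ g)
  have hsub : g '' F ⊆ g '' G ∪ g '' {w ∈ s | ¬DifferentiableAt ℝ g w} := by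
    rw [← image_union]
    refine image_mono fun w hw => ?_
    by_cases h : DifferentiableAt ℝ g w
    · exact Or.inl ⟨hw, h⟩
    · exact Or.inr ⟨hFs hw, h⟩
  calc volume (g '' F) ≤ volume (g '' G) + 0 := by
        rw [← volume_image_not_differentiableAt_eq_zero hg]
        exact (measure_mono hsub).trans (measure_union_le _ _)
    _ ≤ ∫⁻ w in G, ENNReal.ofReal |(fderiv ℝ g w).det| := by
        rw [add_zero]
        exact addHaar_image_le_lintegral_abs_det_fderiv volume hGm
          fun w hw => hw.2.hasFDerivAt.hasFDerivWithinAt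
    _ ≤ ∫⁻ _ in G, ENNReal.ofReal C :=
        setLIntegral_mono measurable_const fun w hw =>
          ENNReal.ofReal_le_ofReal (hC w (hFs hw.1) _ hw.2.hasFDerivAt)
    _ = ENNReal.ofReal C * volume G := setLIntegral_const _ _
    _ ≤ _ := by
        gcongr
        exact inter_subset_left

end

/-- **Corollary 3.** If `Q(z) ≤ K < ∞` for a.e. `z ∈ D`, then for every `z₀ ∈ D` and all
`r ∈ (0, d₀)`, `|fB(z₀,r)| ≥ K^{2/(2-p)} |B(z₀,r)|`. -/
theorem area_image_disc_lower_bound_bounded_Q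
    (p : ℝ) (hp : 2 < p) (D D' : Set ℂ)
    (hDo : IsOpen D) (hDc : IsConnected D) (hDb : Bornology.IsBounded D)
    (hD'o : IsOpen D') (hD'c : IsConnected D') (hD'b : Bornology.IsBounded D')
    (Q : ℂ → ℝ≥0∞) (hQmeas : Measurable Q)
    (f : ℂ → ℂ) (hf : IsQHomeo p D Q f) (hfD : f '' D = D')
    (K : ℝ) (hK : 0 < K)
    (hQK : ∀ᵐ z ∂(volume.restrict D), Q z ≤ ENNReal.ofReal K)
    (z₀ : ℂ) (hz₀ : z₀ ∈ D)
    (r : ℝ) (hr0 : 0 < r) (hr : r < Metric.infDist z₀ (frontier D)) :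
    ENNReal.ofReal (K ^ (2 / (2 - p))) * volume (Metric.closedBall z₀ r) ≤
      volume (f '' Metric.closedBall z₀ r) := by
  subst hfD
  set g := Function.invFunOn f D with hgdef
  have hgf : LeftInvOn g f D := hf.1.2.1.leftInvOn_invFunOn
  have hg : ContinuousOn g (f '' D) := hf.1.continuousOn_invFunOn hDo
  have hgD : ∀ w ∈ f '' D, g w ∈ D := fun w hw => Function.invFunOn_mem hw
  have hfg : ∀ w ∈ f '' D, f (g w) = w := fun w hw => Function.invFunOn_eq hw
  have hB := closedBall_subset_of_lt_infDist_frontier hDo hz₀ hr0.le hr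
  have hF : MeasurableSet (f '' closedBall z₀ r) :=
    ((isCompact_closedBall z₀ r).image_of_continuousOn (hf.1.1.mono hB)).measurableSet
  have key := volume_image_le_of_abs_det_le hF (image_mono hB)
    (fun w hw => hf.exists_lipschitzOnWith_inverse hp hK hQK hD'o hg hgD hfg hw)
    (fun w hw A hA => hf.abs_det_fderiv_inverse_le hp hK hQK hD'o hg hgD hfg hw hA)
  rw [(hgf.mono hB).image_image] at key
  calc _ ≤ ENNReal.ofReal (K ^ (2 / (2 - p))) *
        (ENNReal.ofReal (K ^ (2 / (p - 2))) * volume (f '' closedBall z₀ r)) := by gcongr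
    _ = _ := by
      rw [← mul_assoc, ← ENNReal.ofReal_mul (by positivity), ← Real.rpow_add hK, ← neg_sub p 2,
        div_neg, neg_add_cancel, Real.rpow_zero, ENNReal.ofReal_one, one_mul]
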